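/- arXiv:math/0702263 — 2 statements merged into one kernel-verified Lean document; each statement's English description precedes it below -/
import Mathlib

section
/- (Equivalence with the jet-based definition of viscosity subsolution.) Let u:ℝ^d→ℝ be bounded and upper semicontinuous. The following are equivalent: (ii) for every δ∈(0,1), every C² function φ:ℝ^d→ℝ and every point x at which u−φ attains a maximum over B̄(x,δ), F(x,u(x),∇φ(x),D²φ(x), I^{1,δ}[x,φ] + I^{2,δ}[x,∇φ(x),u]) ≤ 0; (iii) for every δ∈(0,1), every C² function φ:ℝ^d→ℝ, every point x at which u−φ attains a maximum over B̄(x,δ), and every superjet (p,X) of u at x with p = ∇φ(x) and X ≤ D²φ(x), F(x,u(x),p,X, I^{1,δ}[x,φ] + I^{2,δ}[x,∇φ(x),u]) ≤ 0. -/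
open scoped RealInnerProductSpace
open Filter Metric MeasureTheory Topology

/-- The Lévy–Itô operator `I_LI[x,φ]`. -/
noncomputable def ILI {d : ℕ} (μ : Measure (EuclideanSpace ℝ (Fin d)))
    (j : EuclideanSpace ℝ (Fin d) → EuclideanSpace ℝ (Fin d) → EuclideanSpace ℝ (Fin d))
    (x : EuclideanSpace ℝ (Fin d)) (φ : EuclideanSpace ℝ (Fin d) → ℝ) : ℝ :=
  ∫ z, (φ (x + j x z) - φ x -
    ⟪gradient φ x, j x z⟫ *
      (closedBall (0 : EuclideanSpace ℝ (Fin d)) 1).indicator (fun _ => (1:ℝ)) z) ∂μ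

/-- The small-jumps part `I^{1,δ}[x,φ]`. -/
noncomputable def I1 {d : ℕ} (μ : Measure (EuclideanSpace ℝ (Fin d)))
    (j : EuclideanSpace ℝ (Fin d) → EuclideanSpace ℝ (Fin d) → EuclideanSpace ℝ (Fin d))
    (δ : ℝ) (x : EuclideanSpace ℝ (Fin d)) (φ : EuclideanSpace ℝ (Fin d) → ℝ) : ℝ :=
  ∫ z in {z : EuclideanSpace ℝ (Fin d) | ‖z‖ ≤ δ},
    (φ (x + j x z) - φ x - ⟪gradient φ x, j x z⟫) ∂μ

/-- The large-jumps part `I^{2,δ}[x,p,w]`. -/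
noncomputable def I2 {d : ℕ} (μ : Measure (EuclideanSpace ℝ (Fin d)))
    (j : EuclideanSpace ℝ (Fin d) → EuclideanSpace ℝ (Fin d) → EuclideanSpace ℝ (Fin d))
    (δ : ℝ) (x p : EuclideanSpace ℝ (Fin d)) (w : EuclideanSpace ℝ (Fin d) → ℝ) : ℝ :=
  ∫ z in {z : EuclideanSpace ℝ (Fin d) | δ < ‖z‖},
    (w (x + j x z) - w x -
      ⟪p, j x z⟫ * (closedBall (0 : EuclideanSpace ℝ (Fin d)) 1).indicator (fun _ => (1:ℝ)) z) ∂μ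

/-- The Hessian matrix of `φ` at `x`. -/
noncomputable def hessM {d : ℕ} (φ : EuclideanSpace ℝ (Fin d) → ℝ)
    (x : EuclideanSpace ℝ (Fin d)) : Matrix (Fin d) (Fin d) ℝ :=
  Matrix.of fun i j =>
    iteratedFDeriv ℝ 2 φ x ![EuclideanSpace.single i 1, EuclideanSpace.single j 1]

/-- Degenerate ellipticity of `F` (nonincreasing in the matrix and nonlocal slots). -/
def DegEll {d : ℕ}
    (F : EuclideanSpace ℝ (Fin d) → ℝ → EuclideanSpace ℝ (Fin d) →
      Matrix (Fin d) (Fin d) ℝ → ℝ → ℝ) : Prop :=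
  ∀ x u p (M N : Matrix (Fin d) (Fin d) ℝ) (l₁ l₂ : ℝ),
    (M - N).PosSemidef → l₂ ≤ l₁ → F x u p M l₁ ≤ F x u p N l₂


/-- The quadratic form `z ↦ ⟨Az, z⟩` of a matrix `A`. -/
noncomputable def quadF {d : ℕ} (A : Matrix (Fin d) (Fin d) ℝ)
    (z : EuclideanSpace ℝ (Fin d)) : ℝ :=
  ⟪Matrix.toEuclideanLin A z, z⟫

/-- `(p, A)` is a superjet of `u` at `x`. -/
def IsSuperjet {d : ℕ} (u : EuclideanSpace ℝ (Fin d) → ℝ) (x p : EuclideanSpace ℝ (Fin d))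
    (A : Matrix (Fin d) (Fin d) ℝ) : Prop :=
  ∀ ε > 0, ∀ᶠ z in 𝓝 (0 : EuclideanSpace ℝ (Fin d)),
    u (x + z) ≤ u x + ⟪p, z⟫ + (1 / 2) * quadF A z + ε * ‖z‖ ^ 2

namespace ContDiff

variable {E : Type*} [NormedAddCommGroup E] [NormedSpace ℝ E]

/-- Second order Taylor expansion with Peano remainder. -/
theorem taylor_two_isLittleO {f : E → ℝ} (hf : ContDiff ℝ 2 f) (x : E) :
    (fun z => f (x + z) - f x - fderiv ℝ f x z - 1 / 2 * fderiv ℝ (fderiv ℝ f) x z z)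
      =o[𝓝 0] fun z => ‖z‖ ^ 2 := by
  set D := fderiv ℝ (fderiv ℝ f) x with hD
  have hsymm : ∀ v w, D v w = D w v :=
    hf.contDiffAt.isSymmSndFDerivAt (by simp)
  have hd : Differentiable ℝ f := hf.differentiable (by simp)
  have hd' : HasFDerivAt (fderiv ℝ f) D x :=
    ((hf.fderiv_right (m := 1) (by norm_num)).differentiable (by simp) x).hasFDerivAt
  have hg : ∀ z, HasFDerivAt
      (fun z => f (x + z) - f x - fderiv ℝ f x z - 1 / 2 * D z z)
      (fderiv ℝ f (x + z) - fderiv ℝ f x - D z) z := by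
    intro z
    have h1 : HasFDerivAt (fun z => f (x + z)) (fderiv ℝ f (x + z)) z :=
      (hd (x + z)).hasFDerivAt.comp z ((hasFDerivAt_id z).const_add x)
    have h2 : HasFDerivAt (fun z => D z z) _ z :=
      D.hasFDerivAt.clm_apply (hasFDerivAt_id z)
    refine (((h1.sub_const (f x)).sub (fderiv ℝ f x).hasFDerivAt).sub
      (h2.const_mul (1 / 2))).congr_fderiv ?_
    ext w
    simp [hsymm w z]
    ring
  have hlo := hasFDerivAt_iff_isLittleO_nhds_zero.1 hd'
  refine Asymptotics.isLittleO_iff.2 fun c hc => ?_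
  obtain ⟨r, hr, hball⟩ := Metric.eventually_nhds_iff_ball.1 (Asymptotics.isLittleO_iff.1 hlo hc)
  refine Metric.eventually_nhds_iff_ball.2 ⟨r, hr, fun z hz => ?_⟩
  have hz' : ‖z‖ < r := by simpa using hz
  have := (convex_closedBall (0 : E) ‖z‖).norm_image_sub_le_of_norm_hasFDerivWithin_le
    (C := c * ‖z‖) (x := 0) (y := z) (fun w _ => (hg w).hasFDerivWithinAt)
    (fun w hw => by
      have hw' : ‖w‖ ≤ ‖z‖ := by simpa using hw
      refine (hball w (by simpa using hw'.trans_lt hz')).trans ?_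
      gcongr) (by simp) (by simp)
  simpa [pow_two, mul_assoc] using this

end ContDiff

section QuadraticPolynomial

variable {E : Type*} [NormedAddCommGroup E] [NormedSpace ℝ E]

theorem contDiff_quadraticPolynomial (c : ℝ) (L : E →L[ℝ] ℝ) (B : E →L[ℝ] E →L[ℝ] ℝ) (x : E)
    {n : WithTop ℕ∞} :
    ContDiff ℝ n fun y => c + L (y - x) + 1 / 2 * B (y - x) (y - x) := by
  fun_prop

theorem fderiv_quadraticPolynomial (c : ℝ) (L : E →L[ℝ] ℝ) {B : E →L[ℝ] E →L[ℝ] ℝ}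
    (hB : ∀ v w, B v w = B w v) (x : E) :
    fderiv ℝ (fun y => c + L (y - x) + 1 / 2 * B (y - x) (y - x)) = fun y => L + B (y - x) := by
  ext1 y
  have h0 : HasFDerivAt (fun y => y - x) (ContinuousLinearMap.id ℝ E) y :=
    (hasFDerivAt_id y).sub_const x
  have h1 : HasFDerivAt (fun y => B (y - x) (y - x)) _ y :=
    (B.hasFDerivAt.comp y h0).clm_apply h0
  refine (((L.hasFDerivAt.comp y h0).const_add c).add (h1.const_mul (1 / 2))).fderiv.trans ?_
  ext w
  simp only [add_apply, smul_apply,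
    ContinuousLinearMap.comp_apply, ContinuousLinearMap.flip_apply, ContinuousLinearMap.id_apply,
    Function.comp_apply, smul_eq_mul, hB w (y - x)]
  ring

theorem fderiv_fderiv_quadraticPolynomial (c : ℝ) (L : E →L[ℝ] ℝ) {B : E →L[ℝ] E →L[ℝ] ℝ}
    (hB : ∀ v w, B v w = B w v) (x : E) :
    fderiv ℝ (fderiv ℝ fun y => c + L (y - x) + 1 / 2 * B (y - x) (y - x)) x = B := by
  rw [fderiv_quadraticPolynomial c L hB x]
  have h0 : HasFDerivAt (fun y => y - x) (ContinuousLinearMap.id ℝ E) x :=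
    (hasFDerivAt_id x).sub_const x
  exact ((B.hasFDerivAt.comp x h0).const_add L).fderiv

end QuadraticPolynomial

section Hessian

variable {d : ℕ}

/-- The bilinear form `(v, w) ↦ ⟨Av, w⟩` of a matrix `A`. -/
noncomputable def matrixBilin (A : Matrix (Fin d) (Fin d) ℝ) :
    EuclideanSpace ℝ (Fin d) →L[ℝ] EuclideanSpace ℝ (Fin d) →L[ℝ] ℝ :=
  ((innerₗ (EuclideanSpace ℝ (Fin d))).comp (Matrix.toEuclideanLin A)).toContinuousBilinearMap

theorem matrixBilin_apply (A : Matrix (Fin d) (Fin d) ℝ) (v w : EuclideanSpace ℝ (Fin d)) :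
    matrixBilin A v w = ⟪Matrix.toEuclideanLin A v, w⟫ := rfl

theorem matrixBilin_self (A : Matrix (Fin d) (Fin d) ℝ) (v : EuclideanSpace ℝ (Fin d)) :
    matrixBilin A v v = quadF A v := rfl

theorem matrixBilin_single (A : Matrix (Fin d) (Fin d) ℝ) (i j : Fin d) :
    matrixBilin A (EuclideanSpace.single i 1) (EuclideanSpace.single j 1) = A j i := by
  simp [matrixBilin_apply, EuclideanSpace.inner_single_right, Matrix.toLpLin_apply]

theorem matrixBilin_eq_of_single {A : Matrix (Fin d) (Fin d) ℝ}
    {B : EuclideanSpace ℝ (Fin d) →L[ℝ] EuclideanSpace ℝ (Fin d) →L[ℝ] ℝ}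
    (h : ∀ i j, B (EuclideanSpace.single i 1) (EuclideanSpace.single j 1) = A j i) :
    matrixBilin A = B := by
  refine ContinuousLinearMap.coe_injective ((EuclideanSpace.basisFun (Fin d) ℝ).toBasis.ext ?_)
  intro i
  refine ContinuousLinearMap.coe_injective ((EuclideanSpace.basisFun (Fin d) ℝ).toBasis.ext ?_)
  intro j
  simpa [h] using matrixBilin_single A i j

theorem matrixBilin_symm {A : Matrix (Fin d) (Fin d) ℝ} (hA : A.IsSymm)
    (v w : EuclideanSpace ℝ (Fin d)) : matrixBilin A v w = matrixBilin A w v := by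
  have : matrixBilin A = (matrixBilin A).flip :=
    matrixBilin_eq_of_single fun i j => by
      simp [matrixBilin_single, hA.apply]
  conv_lhs => rw [this]
  rfl

theorem hessM_apply (φ : EuclideanSpace ℝ (Fin d) → ℝ) (x : EuclideanSpace ℝ (Fin d))
    (i j : Fin d) :
    hessM φ x i j = fderiv ℝ (fderiv ℝ φ) x (EuclideanSpace.single i 1)
      (EuclideanSpace.single j 1) := by
  simp [hessM, iteratedFDeriv_two_apply]

theorem ContDiff.hessM_isSymm {φ : EuclideanSpace ℝ (Fin d) → ℝ} (hφ : ContDiff ℝ 2 φ)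
    (x : EuclideanSpace ℝ (Fin d)) : (hessM φ x).IsSymm := by
  refine Matrix.IsSymm.ext fun i j => ?_
  simp only [hessM_apply]
  exact hφ.contDiffAt.isSymmSndFDerivAt (by simp) _ _

theorem ContDiff.matrixBilin_hessM {φ : EuclideanSpace ℝ (Fin d) → ℝ} (hφ : ContDiff ℝ 2 φ)
    (x : EuclideanSpace ℝ (Fin d)) : matrixBilin (hessM φ x) = fderiv ℝ (fderiv ℝ φ) x :=
  matrixBilin_eq_of_single fun i j => by
    rw [(hφ.hessM_isSymm x).apply, hessM_apply]

theorem inner_gradient_eq_fderiv (φ : EuclideanSpace ℝ (Fin d) → ℝ)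
    (x z : EuclideanSpace ℝ (Fin d)) : ⟪gradient φ x, z⟫ = fderiv ℝ φ x z := by
  rw [← toDual_gradient, InnerProductSpace.toDual_apply_apply]

theorem ContDiff.taylor_quadF_isLittleO {φ : EuclideanSpace ℝ (Fin d) → ℝ}
    (hφ : ContDiff ℝ 2 φ) (x : EuclideanSpace ℝ (Fin d)) :
    (fun z => φ (x + z) - φ x - ⟪gradient φ x, z⟫ - 1 / 2 * quadF (hessM φ x) z)
      =o[𝓝 0] fun z => ‖z‖ ^ 2 := by
  simpa only [inner_gradient_eq_fderiv, ← matrixBilin_self, hφ.matrixBilin_hessM]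
    using hφ.taylor_two_isLittleO x

theorem quadF_add (A B : Matrix (Fin d) (Fin d) ℝ) (z : EuclideanSpace ℝ (Fin d)) :
    quadF (A + B) z = quadF A z + quadF B z := by
  simp [quadF, inner_add_left]

theorem quadF_sub (A B : Matrix (Fin d) (Fin d) ℝ) (z : EuclideanSpace ℝ (Fin d)) :
    quadF (A - B) z = quadF A z - quadF B z := by
  simp [quadF, inner_sub_left]

theorem quadF_smul_one (c : ℝ) (z : EuclideanSpace ℝ (Fin d)) :
    quadF (c • (1 : Matrix (Fin d) (Fin d) ℝ)) z = c * ‖z‖ ^ 2 := by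
  have h : Matrix.toEuclideanLin (1 : Matrix (Fin d) (Fin d) ℝ) z = z := by
    simp
  rw [quadF, map_smul, LinearMap.smul_apply, h, real_inner_smul_left, real_inner_self_eq_norm_sq]

theorem Matrix.PosSemidef.quadF_nonneg {A : Matrix (Fin d) (Fin d) ℝ} (hA : A.PosSemidef)
    (z : EuclideanSpace ℝ (Fin d)) : 0 ≤ quadF A z := by
  simpa [quadF] using (Matrix.isPositive_toEuclideanLin_iff.2 hA).2 z

theorem ContDiff.isSuperjet_of_eventually_le {φ u : EuclideanSpace ℝ (Fin d) → ℝ}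
    (hφ : ContDiff ℝ 2 φ) {x : EuclideanSpace ℝ (Fin d)}
    (hmax : ∀ᶠ y in 𝓝 x, u y - φ y ≤ u x - φ x) :
    IsSuperjet u x (gradient φ x) (hessM φ x) := by
  intro ε hε
  have hadd : Tendsto (fun z => x + z) (𝓝 0) (𝓝 x) := by
    simpa using (continuous_const_add x).tendsto 0
  filter_upwards [Asymptotics.isLittleO_iff.1 (hφ.taylor_quadF_isLittleO x) hε,
    hadd.eventually hmax] with z h1 h2
  rw [Real.norm_eq_abs, norm_pow, norm_norm] at h1
  linarith [(abs_le.1 h1).2]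

end Hessian

theorem exists_bound_norm_sq_of_isBigO {E : Type*} [NormedAddCommGroup E] [ProperSpace E]
    {h : E → ℝ} (hc : Continuous h) (hO : h =O[𝓝 0] fun z => ‖z‖ ^ 2) (δ : ℝ) :
    ∃ C, ∀ z, ‖z‖ ≤ δ → ‖h z‖ ≤ C * ‖z‖ ^ 2 := by
  obtain ⟨c, hcO⟩ := hO.bound
  obtain ⟨r, hr, hball⟩ := Metric.eventually_nhds_iff_ball.1 hcO
  obtain ⟨M, hM⟩ := (isCompact_closedBall (0 : E) δ).exists_bound_of_continuousOn hc.continuousOn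
  refine ⟨max c (M / r ^ 2), fun z hz => ?_⟩
  rcases lt_or_ge ‖z‖ r with hzr | hzr
  · have := hball z (by simpa using hzr)
    rw [norm_pow, norm_norm] at this
    exact this.trans (by gcongr; exact le_max_left _ _)
  · have hMz := hM z (by simpa using hz)
    have hM0 : 0 ≤ M := (norm_nonneg _).trans hMz
    calc ‖h z‖ ≤ M := hMz
      _ = M / r ^ 2 * r ^ 2 := by field_simp
      _ ≤ M / r ^ 2 * ‖z‖ ^ 2 := by gcongr
      _ ≤ max c (M / r ^ 2) * ‖z‖ ^ 2 := by gcongr; exact le_max_right _ _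

section LevyMeasure

variable {E : Type*} [NormedAddCommGroup E] [MeasurableSpace E] [OpensMeasurableSpace E]
  {μ : Measure E}

theorem integrableOn_norm_sq_of_levy (hμ : ∫⁻ z, ENNReal.ofReal (min (‖z‖ ^ 2) 1) ∂μ < ⊤)
    {δ : ℝ} (hδ : δ ≤ 1) : IntegrableOn (fun z : E => ‖z‖ ^ 2) {z | ‖z‖ ≤ δ} μ := by
  have hms : MeasurableSet {z : E | ‖z‖ ≤ δ} := measurableSet_le measurable_norm measurable_const
  have hmin : Integrable (fun z : E => min (‖z‖ ^ 2) 1) μ := by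
    refine ⟨((measurable_norm.pow_const 2).min measurable_const).aestronglyMeasurable, ?_⟩
    rwa [hasFiniteIntegral_iff_ofReal (ae_of_all _ fun z => by positivity)]
  refine hmin.integrableOn.congr_fun (fun z hz => ?_) hms
  have : ‖z‖ ≤ 1 := le_trans hz hδ
  exact min_eq_left (pow_le_one₀ (norm_nonneg z) this)

end LevyMeasure

section Nonlocal

variable {d : ℕ} {μ : Measure (EuclideanSpace ℝ (Fin d))}

theorem ContDiff.integrableOn_I1 (hμ : ∫⁻ z, ENNReal.ofReal (min (‖z‖ ^ 2) 1) ∂μ < ⊤)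
    {φ : EuclideanSpace ℝ (Fin d) → ℝ} (hφ : ContDiff ℝ 2 φ) (x : EuclideanSpace ℝ (Fin d))
    {δ : ℝ} (hδ : δ ≤ 1) :
    IntegrableOn (fun z => φ (x + z) - φ x - ⟪gradient φ x, z⟫) {z | ‖z‖ ≤ δ} μ := by
  have hcont : Continuous fun z => φ (x + z) - φ x - ⟪gradient φ x, z⟫ := by
    have := hφ.continuous
    fun_prop
  have hquad : (fun z => 1 / 2 * quadF (hessM φ x) z) =O[𝓝 0] fun z => ‖z‖ ^ 2 := by
    refine Asymptotics.IsBigO.of_bound (1 / 2 * ‖matrixBilin (hessM φ x)‖)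
      (Eventually.of_forall fun z => ?_)
    have := (matrixBilin (hessM φ x)).le_opNorm₂ z z
    rw [matrixBilin_self] at this
    calc ‖1 / 2 * quadF (hessM φ x) z‖ = 1 / 2 * ‖quadF (hessM φ x) z‖ := by
          rw [norm_mul, Real.norm_of_nonneg (by norm_num : (0 : ℝ) ≤ 1 / 2)]
      _ ≤ 1 / 2 * (‖matrixBilin (hessM φ x)‖ * ‖z‖ * ‖z‖) := by gcongr
      _ = 1 / 2 * ‖matrixBilin (hessM φ x)‖ * ‖‖z‖ ^ 2‖ := by
          rw [norm_pow, norm_norm]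
          ring
  have hO : (fun z => φ (x + z) - φ x - ⟪gradient φ x, z⟫) =O[𝓝 0] fun z => ‖z‖ ^ 2 := by
    simpa using (hφ.taylor_quadF_isLittleO x).isBigO.add hquad
  obtain ⟨C, hC⟩ := exists_bound_norm_sq_of_isBigO hcont hO δ
  refine ((integrableOn_norm_sq_of_levy hμ hδ).const_mul C).mono'
    hcont.aestronglyMeasurable ?_
  exact ae_restrict_of_forall_mem
    (measurableSet_le measurable_norm measurable_const) fun z hz => hC z hz

theorem I1_le_add_of_le (hμ : ∫⁻ z, ENNReal.ofReal (min (‖z‖ ^ 2) 1) ∂μ < ⊤)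
    {φ ψ : EuclideanSpace ℝ (Fin d) → ℝ} (hφ : ContDiff ℝ 2 φ) (hψ : ContDiff ℝ 2 ψ)
    {x : EuclideanSpace ℝ (Fin d)} {δ c : ℝ} (hδ : δ ≤ 1)
    (hx : ψ x = φ x) (hgrad : gradient ψ x = gradient φ x)
    (hle : ∀ z, ψ (x + z) ≤ φ (x + z) + c * ‖z‖ ^ 2) :
    I1 μ (fun _ z => z) δ x ψ ≤
      I1 μ (fun _ z => z) δ x φ + c * ∫ z in {z | ‖z‖ ≤ δ}, ‖z‖ ^ 2 ∂μ := by
  have hsq := (integrableOn_norm_sq_of_levy hμ hδ).const_mul c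
  rw [I1, I1, ← integral_const_mul, ← integral_add (hφ.integrableOn_I1 hμ x hδ) hsq]
  refine integral_mono (hψ.integrableOn_I1 hμ x hδ)
    ((hφ.integrableOn_I1 hμ x hδ).add hsq) fun z => ?_
  simp only [hx, hgrad]
  linarith [hle z]

/-- A test function touching `u` from above at `x` can be replaced by one whose Hessian at `x` is
as close as desired to the matrix of a given smaller superjet. -/
theorem IsSuperjet.exists_contDiff {u φ : EuclideanSpace ℝ (Fin d) → ℝ} (hφ : ContDiff ℝ 2 φ)
    {x : EuclideanSpace ℝ (Fin d)} {δ : ℝ}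
    (hmax : ∀ y ∈ closedBall x δ, u y - φ y ≤ u x - φ x)
    {X : Matrix (Fin d) (Fin d) ℝ} (hX : X.IsSymm) (hjet : IsSuperjet u x (gradient φ x) X)
    (hle : (hessM φ x - X).PosSemidef) {ε : ℝ} (hε : 0 < ε) :
    ∃ ψ : EuclideanSpace ℝ (Fin d) → ℝ, ContDiff ℝ 2 ψ ∧ ψ x = φ x ∧
      (∀ y ∈ closedBall x δ, u y - ψ y ≤ u x - ψ x) ∧
      gradient ψ x = gradient φ x ∧ hessM ψ x = X + (2 * ε) • (1 : Matrix (Fin d) (Fin d) ℝ) ∧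
      ∀ z, ψ (x + z) ≤ φ (x + z) + 2 * ε * ‖z‖ ^ 2 := by
  set A := X + (2 * ε) • (1 : Matrix (Fin d) (Fin d) ℝ) with hA
  have hAsymm : A.IsSymm := hX.add (Matrix.isSymm_one.smul _)
  have hBsymm := matrixBilin_symm hAsymm
  set q : EuclideanSpace ℝ (Fin d) → ℝ := fun y =>
    φ x + fderiv ℝ φ x (y - x) + 1 / 2 * matrixBilin A (y - x) (y - x) with hq
  have hqC : ContDiff ℝ 2 q := contDiff_quadraticPolynomial _ _ _ _
  have hqx : q x = φ x := by simp [hq]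
  have hqz : ∀ z, q (x + z) =
      φ x + ⟪gradient φ x, z⟫ + 1 / 2 * quadF X z + ε * ‖z‖ ^ 2 := by
    intro z
    simp only [hq, add_sub_cancel_left, matrixBilin_self, inner_gradient_eq_fderiv]
    rw [hA, quadF_add, quadF_smul_one]
    ring
  obtain ⟨r, hr, hball⟩ := Metric.eventually_nhds_iff_ball.1
    ((hjet ε hε).and (Asymptotics.isLittleO_iff.1 (hφ.taylor_quadF_isLittleO x) hε))
  have hqu : ∀ z, ‖z‖ < r → u (x + z) - q (x + z) ≤ u x - φ x := by
    intro z hz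
    have := (hball z (by simpa using hz)).1
    rw [hqz]
    linarith
  have hqφ : ∀ z, ‖z‖ < r → q (x + z) ≤ φ (x + z) + 2 * ε * ‖z‖ ^ 2 := by
    intro z hz
    have h1 := (hball z (by simpa using hz)).2
    rw [Real.norm_eq_abs, norm_pow, norm_norm] at h1
    have h2 := hle.quadF_nonneg z
    rw [quadF_sub] at h2
    rw [hqz]
    linarith [(abs_le.1 h1).1]
  let χ : ContDiffBump x := ⟨r / 2, r, by positivity, by linarith⟩
  set ψ : EuclideanSpace ℝ (Fin d) → ℝ := fun y => φ y + χ y * (q y - φ y) with hψ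
  have hψq : ψ =ᶠ[𝓝 x] q := by
    filter_upwards [χ.eventuallyEq_one] with y hy
    simp [hψ, hy]
  have hχ : ∀ y, ¬ ‖y - x‖ < r → χ y = 0 := fun y hy =>
    χ.zero_of_le_dist (by rw [dist_eq_norm]; exact not_lt.1 hy)
  have hψx : ψ x = φ x := hψq.eq_of_nhds.trans hqx
  refine ⟨ψ, hφ.add (χ.contDiff.mul (hqC.sub hφ)), hψx, fun y hy => ?_, ?_, ?_, fun z => ?_⟩
  · rw [hψx]
    have h1 := hmax y hy
    by_cases hyr : ‖y - x‖ < r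
    · have h2 := hqu (y - x) hyr
      rw [add_sub_cancel] at h2
      have h3 := χ.nonneg (x := y)
      have h4 := χ.le_one (x := y)
      simp only [hψ]
      nlinarith
    · simpa [hψ, hχ y hyr] using h1
  · rw [gradient, gradient, hψq.fderiv_eq, fderiv_quadraticPolynomial _ _ hBsymm]
    simp
  · ext i j
    rw [hessM_apply, hψq.fderiv.fderiv_eq, fderiv_fderiv_quadraticPolynomial _ _ hBsymm,
      matrixBilin_single, hAsymm.apply]
  · by_cases hzr : ‖z‖ < r
    · have h2 := hqφ z hzr
      have h3 := χ.nonneg (x := x + z)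
      have h4 := χ.le_one (x := x + z)
      have h5 : 0 ≤ 2 * ε * ‖z‖ ^ 2 := by positivity
      simp only [hψ]
      nlinarith
    · have h5 : 0 ≤ 2 * ε * ‖z‖ ^ 2 := by positivity
      simpa [hψ, hχ (x + z) (by simpa using hzr)] using h5

end Nonlocal

/-- equivalence of the test-function based definition and the jet-based
definition of viscosity subsolution (for the Lévy operator, i.e. `j(x,z) = z`). -/
theorem statement13 {d : ℕ} (μ : Measure (EuclideanSpace ℝ (Fin d)))
    (hLevy : ∫⁻ z, ENNReal.ofReal (min (‖z‖ ^ 2) 1) ∂μ < ⊤)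
    (F : EuclideanSpace ℝ (Fin d) → ℝ → EuclideanSpace ℝ (Fin d) →
      Matrix (Fin d) (Fin d) ℝ → ℝ → ℝ)
    (hFc : Continuous fun ξ : EuclideanSpace ℝ (Fin d) × ℝ × EuclideanSpace ℝ (Fin d) ×
      Matrix (Fin d) (Fin d) ℝ × ℝ => F ξ.1 ξ.2.1 ξ.2.2.1 ξ.2.2.2.1 ξ.2.2.2.2)
    (hFe : DegEll F)
    (u : EuclideanSpace ℝ (Fin d) → ℝ)
    (hu : UpperSemicontinuous u) (hub : ∃ C, ∀ x, |u x| ≤ C) :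
    (∀ δ : ℝ, 0 < δ → δ < 1 →
      ∀ φ : EuclideanSpace ℝ (Fin d) → ℝ, ContDiff ℝ 2 φ →
        ∀ x : EuclideanSpace ℝ (Fin d), (∀ y ∈ closedBall x δ, u y - φ y ≤ u x - φ x) →
          F x (u x) (gradient φ x) (hessM φ x)
            (I1 μ (fun _ z => z) δ x φ + I2 μ (fun _ z => z) δ x (gradient φ x) u) ≤ 0) ↔
    (∀ δ : ℝ, 0 < δ → δ < 1 →
      ∀ φ : EuclideanSpace ℝ (Fin d) → ℝ, ContDiff ℝ 2 φ →
        ∀ x : EuclideanSpace ℝ (Fin d), (∀ y ∈ closedBall x δ, u y - φ y ≤ u x - φ x) →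
          ∀ (p : EuclideanSpace ℝ (Fin d)) (X : Matrix (Fin d) (Fin d) ℝ),
            X.IsSymm → IsSuperjet u x p X → p = gradient φ x →
            (hessM φ x - X).PosSemidef →
            F x (u x) p X
              (I1 μ (fun _ z => z) δ x φ + I2 μ (fun _ z => z) δ x (gradient φ x) u) ≤ 0) := by
  constructor
  · intro h δ hδ0 hδ1 φ hφ x hmax p X hX hjet hp hle
    subst hp
    set K := ∫ z in {z : EuclideanSpace ℝ (Fin d) | ‖z‖ ≤ δ}, ‖z‖ ^ 2 ∂μ
    set l := I1 μ (fun _ z => z) δ x φ + I2 μ (fun _ z => z) δ x (gradient φ x) u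
    have hpert : ∀ ε : ℝ, 0 < ε → F x (u x) (gradient φ x)
        (X + (2 * ε) • (1 : Matrix (Fin d) (Fin d) ℝ)) (l + 2 * ε * K) ≤ 0 := by
      intro ε hε
      obtain ⟨ψ, hψ, hψx, hψmax, hψgrad, hψhess, hψle⟩ := hjet.exists_contDiff hφ hmax hX hle hε
      have hI := I1_le_add_of_le hLevy hφ hψ hδ1.le hψx hψgrad hψle
      have hF := h δ hδ0 hδ1 ψ hψ x hψmax
      rw [hψgrad, hψhess] at hF
      refine (hFe _ _ _ _ _ _ _ ?_ ?_).trans hF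
      · rw [sub_self]
        exact Matrix.PosSemidef.zero
      · simp only [l, K]
        linarith
    have hcont : Continuous fun ε : ℝ => F x (u x) (gradient φ x)
        (X + (2 * ε) • (1 : Matrix (Fin d) (Fin d) ℝ)) (l + 2 * ε * K) :=
      hFc.comp (f := fun ε : ℝ => (x, u x, gradient φ x,
        X + (2 * ε) • (1 : Matrix (Fin d) (Fin d) ℝ), l + 2 * ε * K)) (by fun_prop)
    have hlim := hcont.tendsto 0
    simp only [mul_zero, zero_smul, zero_mul, add_zero] at hlim
    exact le_of_tendsto (hlim.mono_left nhdsWithin_le_nhds)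
      (eventually_nhdsWithin_of_forall (s := Set.Ioi 0) hpert)
  · intro h δ hδ0 hδ1 φ hφ x hmax
    refine h δ hδ0 hδ1 φ hφ x hmax _ _ (hφ.hessM_isSymm x)
      (hφ.isSuperjet_of_eventually_le ?_) rfl ?_
    · exact Filter.eventually_of_mem (closedBall_mem_nhds x hδ0) hmax
    · rw [sub_self]
      exact Matrix.PosSemidef.zero
end

section
/- Assume in addition that μ is symmetric (invariant under z ↦ −z). Let u:ℝ^d→ℝ be a bounded usc viscosity subsolution of F(x,w,∇w,D²w,I_L[x,w]) = 0. Let φ:ℝ^d→ℝ be bounded and C², let x be a global maximum point of u−φ, and set p := ∇φ(x). Then: (a) for every δ∈(0,1) the integral I^{2,δ}[x,p,u] is well defined and the limit I^{2,0}[x,p,u] := lim_{δ→0⁺} I^{2,δ}[x,p,u] exists in {−∞}∪ℝ; (b) if I^{2,0}[x,p,u] is finite then F(x,u(x),∇φ(x),D²φ(x), I^{2,0}[x,p,u]) ≤ 0, while if I^{2,0}[x,p,u] = −∞ then inf_{l∈ℝ} F(x,u(x),∇φ(x),D²φ(x),l) ≤ 0; (c) if F(x,u(x),∇φ(x),D²φ(x),l)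 → +∞ as l→−∞, then I^{2,0}[x,p,u] is finite. -/
open scoped RealInnerProductSpace
open Filter Metric MeasureTheory Topology

/-- `u` is a (bounded, usc) viscosity subsolution of `F(x,u,∇u,D²u,I_LI[x,u]) = 0`. -/
def IsSubsolution {d : ℕ}
    (F : EuclideanSpace ℝ (Fin d) → ℝ → EuclideanSpace ℝ (Fin d) →
      Matrix (Fin d) (Fin d) ℝ → ℝ → ℝ)
    (μ : Measure (EuclideanSpace ℝ (Fin d)))
    (j : EuclideanSpace ℝ (Fin d) → EuclideanSpace ℝ (Fin d) → EuclideanSpace ℝ (Fin d))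
    (u : EuclideanSpace ℝ (Fin d) → ℝ) : Prop :=
  ∀ φ : EuclideanSpace ℝ (Fin d) → ℝ, ContDiff ℝ 2 φ → (∃ C, ∀ y, |φ y| ≤ C) →
    ∀ x : EuclideanSpace ℝ (Fin d), (∀ y, u y - φ y ≤ u x - φ x) →
      F x (u x) (gradient φ x) (hessM φ x) (ILI μ j x φ) ≤ 0


section Auxiliary

variable {E : Type*} [NormedAddCommGroup E]

/-- Fatou's lemma at a non-integrable limit: the integrals of nonnegative functions converging
pointwise to a non-integrable function tend to infinity. -/
theorem tendsto_integral_atTop_of_not_integrable {α ι : Type*} [MeasurableSpace α]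
    {μ : Measure α} {l : Filter ι} [l.NeBot] [l.IsCountablyGenerated] {f : ι → α → ℝ} {g : α → ℝ}
    (hfm : ∀ i, Measurable (f i)) (hf0 : ∀ i a, 0 ≤ f i a)
    (hfi : ∀ᶠ i in l, Integrable (f i) μ) (hgm : Measurable g) (hg0 : ∀ a, 0 ≤ g a)
    (hlim : ∀ a, Tendsto (fun i => f i a) l (𝓝 (g a))) (hg : ¬ Integrable g μ) :
    Tendsto (fun i => ∫ a, f i a ∂μ) l atTop := by
  have htop : ∫⁻ a, ENNReal.ofReal (g a) ∂μ = ⊤ := by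
    by_contra h
    exact hg ⟨hgm.aestronglyMeasurable,
      (hasFiniteIntegral_iff_ofReal (ae_of_all _ hg0)).2 (lt_top_iff_ne_top.2 h)⟩
  have hfatou := lintegral_liminf_le (μ := μ) (u := l)
    (f := fun i a => ENNReal.ofReal (f i a)) (fun i => (hfm i).ennreal_ofReal)
  have hlim' : ∀ a, liminf (fun i => ENNReal.ofReal (f i a)) l = ENNReal.ofReal (g a) :=
    fun a => (ENNReal.tendsto_ofReal (hlim a)).liminf_eq
  simp only [hlim', htop] at hfatou
  have hlint : Tendsto (fun i => ∫⁻ a, ENNReal.ofReal (f i a) ∂μ) l (𝓝 ⊤) :=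
    tendsto_of_le_liminf_of_limsup_le hfatou le_top
  refine ENNReal.tendsto_ofReal_nhds_top.1 (hlint.congr' ?_)
  filter_upwards [hfi] with i hi
  exact (ofReal_integral_eq_lintegral_ofReal hi (ae_of_all _ (hf0 i))).symm

/-- Second-order Taylor bound on a unit ball for a `C²` function. -/
theorem exists_taylor_bound [NormedSpace ℝ E] [ProperSpace E] {φ : E → ℝ} (hφ : ContDiff ℝ 2 φ)
    (x : E) :
    ∃ C, 0 ≤ C ∧ ∀ z, ‖z‖ ≤ 1 → |φ (x + z) - φ x - fderiv ℝ φ x z| ≤ C * ‖z‖ ^ 2 := by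
  have hd : ContDiff ℝ 1 (fderiv ℝ φ) := hφ.fderiv_right (by norm_num)
  obtain ⟨C, hC⟩ := (isCompact_closedBall x 1).exists_bound_of_continuousOn
    (hd.continuous_fderiv (by norm_num)).continuousOn
  have hC0 : 0 ≤ C := (norm_nonneg _).trans (hC x (mem_closedBall_self zero_le_one))
  refine ⟨C, hC0, fun z hz => ?_⟩
  have hsub : closedBall x ‖z‖ ⊆ closedBall x 1 := closedBall_subset_closedBall hz
  have hx : x ∈ closedBall x ‖z‖ := mem_closedBall_self (norm_nonneg z)
  have hxz : x + z ∈ closedBall x ‖z‖ := by simp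
  have hlip : ∀ y ∈ closedBall x ‖z‖, ‖fderiv ℝ φ y - fderiv ℝ φ x‖ ≤ C * ‖z‖ := by
    intro y hy
    calc ‖fderiv ℝ φ y - fderiv ℝ φ x‖ ≤ C * ‖y - x‖ :=
          (convex_closedBall x ‖z‖).norm_image_sub_le_of_norm_fderiv_le
            (fun w _ => (hd.differentiable (by norm_num)) w) (fun w hw => hC w (hsub hw)) hx hy
      _ ≤ C * ‖z‖ := by gcongr; exact mem_closedBall_iff_norm.1 hy
  have h := (convex_closedBall x ‖z‖).norm_image_sub_le_of_norm_fderiv_le'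
    (fun w _ => (hφ.differentiable (by norm_num)) w) hlip hx hxz
  simpa [pow_two, mul_assoc] using h

/-- A `C²` function above an upper semicontinuous `u`, equal to a given `C²` majorant `ψ` of `u`
near `x`, almost below `ψ` everywhere, and almost below nearby values of `u` away from `x`. -/
theorem exists_contDiff_majorant [NormedSpace ℝ E] [FiniteDimensional ℝ E] {u ψ : E → ℝ}
    (hu : UpperSemicontinuous u) (hψ : ContDiff ℝ 2 ψ) (huψ : ∀ y, u y ≤ ψ y) (x : E)
    {δ ε : ℝ} (hδ : 0 < δ) (hε : 0 < ε) :
    ∃ g : E → ℝ, ContDiff ℝ 2 g ∧ (∀ y, u y ≤ g y) ∧ (∀ y, g y ≤ ψ y + ε) ∧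
      (∀ y, dist y x < δ → g y = ψ y) ∧
      ∀ y, 2 * δ ≤ dist y x → ∃ z, dist z y < δ ∧ g y ≤ u z + ε := by
  let t : E → Set ℝ := fun y => {c | u y ≤ c ∧ c ≤ ψ y + ε ∧ (dist y x < δ → c = ψ y) ∧
    (2 * δ ≤ dist y x → ∃ z, dist z y < δ ∧ c ≤ u z + ε)}
  have ht : ∀ y, Convex ℝ (t y) := by
    refine fun y => Set.OrdConnected.convex ⟨?_⟩
    rintro a ⟨ha1, -, ha3, -⟩ b ⟨-, hb2, hb3, hb4⟩ c ⟨hac, hcb⟩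
    refine ⟨ha1.trans hac, hcb.trans hb2, fun hy => ?_, fun hy => ?_⟩
    · exact le_antisymm (hcb.trans (hb3 hy).le) ((ha3 hy).ge.trans hac)
    · obtain ⟨z, hz, hbz⟩ := hb4 hy
      exact ⟨z, hz, hcb.trans hbz⟩
  have hloc : ∀ y₀ : E, ∃ U ∈ 𝓝 y₀, ∃ g : E → ℝ, ContMDiffOn (modelWithCornersSelf ℝ E)
      (modelWithCornersSelf ℝ ℝ) 2 g U ∧ ∀ y ∈ U, g y ∈ t y := by
    intro y₀
    rcases lt_or_ge (dist y₀ x) (2 * δ) with h | h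
    · refine ⟨{y | dist y x < 2 * δ}, (continuous_id.dist continuous_const).continuousAt.eventually_lt
        continuousAt_const h, ψ, hψ.contMDiff.contMDiffOn, fun y hy => ?_⟩
      exact ⟨huψ y, by linarith, fun _ => rfl, fun h' => absurd hy (not_lt.2 h')⟩
    · have h1 : ∀ᶠ y in 𝓝 y₀, u y < u y₀ + ε / 2 := hu y₀ _ (by linarith)
      have h2 : ∀ᶠ y in 𝓝 y₀, ψ y₀ - ε / 2 < ψ y :=
        hψ.continuous.continuousAt.eventually_const_lt (by linarith)
      have h3 : ∀ᶠ y in 𝓝 y₀, δ < dist y x :=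
        (continuous_id.dist continuous_const).continuousAt.eventually_const_lt
          (by simpa using by linarith)
      have h4 : ∀ᶠ y in 𝓝 y₀, dist y₀ y < δ := by
        filter_upwards [ball_mem_nhds y₀ hδ] with y hy
        rwa [dist_comm]
      refine ⟨_, (h1.and (h2.and (h3.and h4))), fun _ => u y₀ + ε / 2, contMDiffOn_const, ?_⟩
      rintro y ⟨k1, k2, k3, k4⟩
      have := huψ y₀
      exact ⟨k1.le, by linarith, fun h' => absurd k3 (not_lt.2 h'.le),
        fun _ => ⟨y₀, k4, by linarith⟩⟩
  obtain ⟨g, hg⟩ := exists_contMDiffMap_forall_mem_convex_of_local (n := 2)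
    (modelWithCornersSelf ℝ E) ht hloc
  exact ⟨g, g.contMDiff.contDiff, fun y => (hg y).1, fun y => (hg y).2.1,
    fun y => (hg y).2.2.1, fun y => (hg y).2.2.2⟩

/-- A measurable function dominated by a multiple of `min (‖z‖²) 1` is integrable against a
Lévy measure. -/
theorem integrable_of_le_mul_min [MeasurableSpace E] [OpensMeasurableSpace E] {μ : Measure E}
    (hμ : ∫⁻ z, ENNReal.ofReal (min (‖z‖ ^ 2) 1) ∂μ < ⊤) {f : E → ℝ} (hf : Measurable f) (C : ℝ)
    (hC : ∀ z, |f z| ≤ C * min (‖z‖ ^ 2) 1) : Integrable f μ := by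
  have hq : Integrable (fun z : E => min (‖z‖ ^ 2) 1) μ :=
    ⟨((measurable_norm.pow_const 2).min measurable_const).aestronglyMeasurable,
      (hasFiniteIntegral_iff_ofReal (ae_of_all _ fun z => by positivity)).2 hμ⟩
  exact (hq.const_mul C).mono' hf.aestronglyMeasurable (ae_of_all _ hC)

/-- A sequence of `C²` majorants of an upper semicontinuous `u` converging to `u` pointwise, each of
them equal near `x` to a given `C²` majorant `ψ` touching `u` at `x`. -/
theorem exists_seq_contDiff_majorant [NormedSpace ℝ E] [FiniteDimensional ℝ E] {u ψ : E → ℝ}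
    (hu : UpperSemicontinuous u) (hψ : ContDiff ℝ 2 ψ) (huψ : ∀ y, u y ≤ ψ y) {x : E}
    (hx : u x = ψ x) :
    ∃ (g : ℕ → E → ℝ) (δ : ℕ → ℝ), (∀ n, 0 < δ n ∧ δ n ≤ 1) ∧ (∀ n, ContDiff ℝ 2 (g n)) ∧
      (∀ n y, u y ≤ g n y) ∧ (∀ n y, g n y ≤ ψ y + δ n ^ 2) ∧
      (∀ n y, dist y x < δ n → g n y = ψ y) ∧
      ∀ y, Tendsto (fun n => g n y) atTop (𝓝 (u y)) := by
  have hδ : ∀ n : ℕ, 0 < 1 / ((n : ℝ) + 1) := fun n => Nat.one_div_pos_of_nat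
  have hδ1 : ∀ n : ℕ, 1 / ((n : ℝ) + 1) ≤ 1 := fun n => by
    rw [div_le_one (by positivity)]; linarith [n.cast_nonneg (α := ℝ)]
  choose g hg hug hgψ heq hnear using fun n : ℕ =>
    exists_contDiff_majorant hu hψ huψ x (hδ n) (pow_pos (hδ n) 2)
  refine ⟨g, fun n => 1 / ((n : ℝ) + 1), fun n => ⟨hδ n, hδ1 n⟩, hg, hug, hgψ, heq, fun y => ?_⟩
  rcases eq_or_ne y x with rfl | hyx
  · have : ∀ n, g n y = u y := fun n => by rw [heq n y (by simpa using hδ n), hx]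
    simp [this]
  have hδlim : Tendsto (fun n : ℕ => 1 / ((n : ℝ) + 1)) atTop (𝓝 0) :=
    tendsto_one_div_add_atTop_nhds_zero_nat
  refine tendsto_order.2 ⟨fun a ha => Eventually.of_forall fun n => ha.trans_le (hug n y),
    fun b hb => ?_⟩
  obtain ⟨r, hr, hball⟩ := Metric.eventually_nhds_iff.1 (hu y ((u y + b) / 2) (by linarith))
  filter_upwards [hδlim.eventually_lt_const hr,
    (hδlim.const_mul 2).eventually_lt_const (show 2 * (0 : ℝ) < dist y x by
      rw [mul_zero]; exact dist_pos.2 hyx),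
    (hδlim.pow 2).eventually_lt_const (show (0 : ℝ) ^ 2 < (b - u y) / 2 by norm_num; linarith)]
    with n h1 h2 h3
  obtain ⟨z, hz, hgz⟩ := hnear n y h2.le
  have := hball (hz.trans h1)
  linarith

/-- A bounded measurable function vanishing near the origin is integrable against a
Lévy measure. -/
theorem integrable_of_bounded_of_eq_zero [MeasurableSpace E] [OpensMeasurableSpace E]
    {μ : Measure E} (hμ : ∫⁻ z, ENNReal.ofReal (min (‖z‖ ^ 2) 1) ∂μ < ⊤) {f : E → ℝ}
    (hf : Measurable f) {M δ : ℝ} (hM : ∀ z, |f z| ≤ M) (hδ : 0 < δ)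
    (h0 : ∀ z, ‖z‖ < δ → f z = 0) : Integrable f μ := by
  refine integrable_of_le_mul_min hμ hf (M / min (δ ^ 2) 1) fun z => ?_
  have hM0 : 0 ≤ M := (abs_nonneg _).trans (hM z)
  have hm : 0 < min (δ ^ 2) 1 := by positivity
  rcases lt_or_ge ‖z‖ δ with h | h
  · rw [h0 z h, abs_zero]; positivity
  · rw [div_mul_eq_mul_div, le_div_iff₀ hm]
    gcongr
    exact hM z

/-- The compensated increment of a bounded `C²` function is dominated by a multiple of
`min (‖z‖²) 1`. -/
theorem exists_compensated_bound [InnerProductSpace ℝ E] [FiniteDimensional ℝ E] {φ : E → ℝ}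
    (hφ : ContDiff ℝ 2 φ) {M : ℝ} (hM : ∀ y, |φ y| ≤ M) (x : E) :
    ∃ C, ∀ z, |φ (x + z) - φ x -
      ⟪gradient φ x, z⟫ * (closedBall (0 : E) 1).indicator (fun _ => (1 : ℝ)) z| ≤
        C * min (‖z‖ ^ 2) 1 := by
  obtain ⟨C, hC0, hC⟩ := exists_taylor_bound hφ x
  refine ⟨C + 2 * M, fun z => ?_⟩
  have hM0 : 0 ≤ M := (abs_nonneg _).trans (hM x)
  rcases le_or_gt ‖z‖ 1 with h | h
  · have hz : z ∈ closedBall (0 : E) 1 := by simpa using h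
    rw [Set.indicator_of_mem hz, mul_one, gradient, InnerProductSpace.toDual_symm_apply,
      min_eq_left (pow_le_one₀ (norm_nonneg z) h)]
    exact (hC z h).trans (by gcongr; linarith)
  · have hz : z ∉ closedBall (0 : E) 1 := by simpa using h
    rw [Set.indicator_of_notMem hz, mul_zero, sub_zero, min_eq_right (one_le_pow₀ h.le), mul_one]
    calc |φ (x + z) - φ x| ≤ |φ (x + z)| + |φ x| := abs_sub _ _
      _ ≤ C + 2 * M := by linarith [hM (x + z), hM x]

end Auxiliary

theorem gradient_eq_of_eventuallyEq_add_const {d : ℕ} {f φ : EuclideanSpace ℝ (Fin d) → ℝ}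
    {x : EuclideanSpace ℝ (Fin d)} {c : ℝ} (h : f =ᶠ[𝓝 x] fun y => φ y + c) :
    gradient f x = gradient φ x := by
  rw [gradient, gradient, h.fderiv_eq, fderiv_add_const]

theorem hessM_eq_of_eventuallyEq_add_const {d : ℕ} {f φ : EuclideanSpace ℝ (Fin d) → ℝ}
    {x : EuclideanSpace ℝ (Fin d)} {c : ℝ} (h : f =ᶠ[𝓝 x] fun y => φ y + c) :
    hessM f x = hessM φ x := by
  have h' : fderiv ℝ f =ᶠ[𝓝 x] fderiv ℝ φ :=
    h.fderiv.trans (Eventually.of_forall fun y => fderiv_add_const c)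
  ext i j
  simp only [hessM, Matrix.of_apply, iteratedFDeriv_two_apply, h'.fderiv_eq]

/-- at a global maximum point of `u − φ`, the large-jump integral using
`u` itself is well defined, its limit `I^{2,0}[x,p,u]` exists in `{−∞} ∪ ℝ`, and the
viscosity inequality holds with this limit. -/
theorem statement14 {d : ℕ} (μ : Measure (EuclideanSpace ℝ (Fin d)))
    (hLevy : ∫⁻ z, ENNReal.ofReal (min (‖z‖ ^ 2) 1) ∂μ < ⊤)
    (hsym : μ.map (fun z => -z) = μ)
    (F : EuclideanSpace ℝ (Fin d) → ℝ → EuclideanSpace ℝ (Fin d) →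
      Matrix (Fin d) (Fin d) ℝ → ℝ → ℝ)
    (hFc : Continuous fun ξ : EuclideanSpace ℝ (Fin d) × ℝ × EuclideanSpace ℝ (Fin d) ×
      Matrix (Fin d) (Fin d) ℝ × ℝ => F ξ.1 ξ.2.1 ξ.2.2.1 ξ.2.2.2.1 ξ.2.2.2.2)
    (hFe : DegEll F)
    (u : EuclideanSpace ℝ (Fin d) → ℝ)
    (hu : UpperSemicontinuous u) (hub : ∃ C, ∀ x, |u x| ≤ C)
    (husub : IsSubsolution F μ (fun _ z => z) u)
    (φ : EuclideanSpace ℝ (Fin d) → ℝ) (hφ : ContDiff ℝ 2 φ) (hφb : ∃ C, ∀ y, |φ y| ≤ C)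
    (x : EuclideanSpace ℝ (Fin d)) (hmax : ∀ y, u y - φ y ≤ u x - φ x)
    (p : EuclideanSpace ℝ (Fin d)) (hp : p = gradient φ x) :
    -- (a) well-posedness of `I^{2,δ}[x,p,u]` and existence of the limit in `{−∞} ∪ ℝ`
    (∀ δ : ℝ, 0 < δ → δ < 1 →
      MeasureTheory.IntegrableOn
        (fun z => u (x + z) - u x -
          ⟪p, z⟫ * (closedBall (0 : EuclideanSpace ℝ (Fin d)) 1).indicator (fun _ => (1:ℝ)) z)
        {z : EuclideanSpace ℝ (Fin d) | δ < ‖z‖} μ) ∧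
    ((∃ Λ : ℝ, Tendsto (fun δ => I2 μ (fun _ z => z) δ x p u) (𝓝[>] (0:ℝ)) (𝓝 Λ)) ∨
      Tendsto (fun δ => I2 μ (fun _ z => z) δ x p u) (𝓝[>] (0:ℝ)) atBot) ∧
    -- (b) the viscosity inequality with the limiting nonlocal term
    (∀ Λ : ℝ, Tendsto (fun δ => I2 μ (fun _ z => z) δ x p u) (𝓝[>] (0:ℝ)) (𝓝 Λ) →
      F x (u x) (gradient φ x) (hessM φ x) Λ ≤ 0) ∧
    (Tendsto (fun δ => I2 μ (fun _ z => z) δ x p u) (𝓝[>] (0:ℝ)) atBot →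
      ∀ ε > (0:ℝ), ∃ l : ℝ, F x (u x) (gradient φ x) (hessM φ x) l ≤ ε) ∧
    -- (c) coercivity of `F` in the nonlocal slot forces finiteness of the limit
    (Tendsto (fun l => F x (u x) (gradient φ x) (hessM φ x) l) atBot atTop →
      ∃ Λ : ℝ, Tendsto (fun δ => I2 μ (fun _ z => z) δ x p u) (𝓝[>] (0:ℝ)) (𝓝 Λ)) := by
  obtain ⟨Cu, hCu⟩ := hub
  obtain ⟨Cφ, hCφ⟩ := hφb
  have hum : Measurable u := hu.measurable
  set q : EuclideanSpace ℝ (Fin d) → ℝ := fun z => min (‖z‖ ^ 2) 1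
  set ψ : EuclideanSpace ℝ (Fin d) → ℝ := fun y => φ y + (u x - φ x) with hψdef
  set A : EuclideanSpace ℝ (Fin d) → ℝ := fun z => φ (x + z) - φ x - ⟪p, z⟫ *
    (closedBall (0 : EuclideanSpace ℝ (Fin d)) 1).indicator (fun _ => (1:ℝ)) z with hA
  set k : EuclideanSpace ℝ (Fin d) → ℝ := fun z => ψ (x + z) - u (x + z) with hk
  have hψ : ContDiff ℝ 2 ψ := hφ.add contDiff_const
  have huψ : ∀ y, u y ≤ ψ y := fun y => by
    have := hmax y
    simp only [hψdef]; linarith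
  have hψx : u x = ψ x := by simp [hψdef]
  have hqm : Measurable q := by fun_prop
  have hq0 : ∀ z, 0 ≤ q z := fun z => by positivity
  have hqi : Integrable q μ := integrable_of_le_mul_min hLevy hqm 1 fun z => by
    rw [abs_of_nonneg (hq0 z), one_mul]
  have hAm : Measurable A := by
    have h1 : Measurable fun z => φ (x + z) :=
      (hφ.continuous.comp (continuous_const.add continuous_id)).measurable
    have h2 : Measurable ((closedBall (0 : EuclideanSpace ℝ (Fin d)) 1).indicator
        fun _ => (1:ℝ)) := measurable_const.indicator isClosed_closedBall.measurableSet
    have h3 : Measurable fun z : EuclideanSpace ℝ (Fin d) => ⟪p, z⟫ := by fun_prop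
    exact (h1.sub_const _).sub (h3.mul h2)
  have hAi : Integrable A μ := by
    obtain ⟨C, hC⟩ := exists_compensated_bound hφ hCφ x
    exact integrable_of_le_mul_min hLevy hAm C (by simpa only [hA, hp] using hC)
  have hkm : Measurable k :=
    (hψ.continuous.measurable.comp (measurable_const_add x)).sub
      (hum.comp (measurable_const_add x))
  have hk0 : ∀ z, 0 ≤ k z := fun z => sub_nonneg.2 (huψ _)
  have hkx : k 0 = 0 := by simp [hk, hψx]
  have hψb : ∀ y, |ψ y| ≤ Cφ + (Cu + Cφ) := fun y =>
    (abs_add_le _ _).trans (add_le_add (hCφ y)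
      ((abs_sub _ _).trans (add_le_add (hCu x) (hCφ x))))
  have hkb : ∀ z, |k z| ≤ Cφ + (Cu + Cφ) + Cu := fun z =>
    (abs_sub _ _).trans (add_le_add (hψb _) (hCu _))
  have hint : ∀ z, u (x + z) - u x - ⟪p, z⟫ *
      (closedBall (0 : EuclideanSpace ℝ (Fin d)) 1).indicator (fun _ => (1:ℝ)) z =
        A z - k z := fun z => by simp only [hA, hk, hψdef]; ring
  have hSm : ∀ δ : ℝ, MeasurableSet {z : EuclideanSpace ℝ (Fin d) | δ < ‖z‖} := fun δ =>
    measurableSet_lt measurable_const measurable_norm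
  have hkS : ∀ δ : ℝ, 0 < δ →
      Integrable ({z : EuclideanSpace ℝ (Fin d) | δ < ‖z‖}.indicator k) μ := fun δ hδ =>
    integrable_of_bounded_of_eq_zero hLevy (hkm.indicator (hSm δ))
      (fun z => (norm_indicator_le_norm_self k z).trans (hkb z)) hδ
      fun z hz => Set.indicator_of_notMem (by simpa using hz.le) _
  have hI2 : ∀ δ : ℝ, 0 < δ → I2 μ (fun _ z => z) δ x p u =
      ∫ z, {z : EuclideanSpace ℝ (Fin d) | δ < ‖z‖}.indicator A z ∂μ -
        ∫ z, {z : EuclideanSpace ℝ (Fin d) | δ < ‖z‖}.indicator k z ∂μ := fun δ hδ => by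
    rw [integral_indicator (hSm δ), integral_indicator (hSm δ), ← integral_sub hAi.integrableOn
      ((integrable_indicator_iff (hSm δ)).1 (hkS δ hδ))]
    simp only [I2, hint]
  have hindlim : ∀ f : EuclideanSpace ℝ (Fin d) → ℝ, f 0 = 0 → ∀ z,
      Tendsto (fun δ : ℝ => {z : EuclideanSpace ℝ (Fin d) | δ < ‖z‖}.indicator f z)
        (𝓝[>] (0:ℝ)) (𝓝 (f z)) := fun f hf z => by
    refine tendsto_const_nhds.congr' ?_
    rcases eq_or_ne z 0 with rfl | hz
    · exact Eventually.of_forall fun δ => by simp [Set.indicator_apply, hf]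
    · filter_upwards [nhdsWithin_le_nhds (eventually_lt_nhds (norm_pos_iff.2 hz))] with δ hδ
      exact (Set.indicator_of_mem (s := {z | δ < ‖z‖}) hδ f).symm
  have hintlim : ∀ f : EuclideanSpace ℝ (Fin d) → ℝ, f 0 = 0 → Integrable f μ →
      Tendsto (fun δ : ℝ => ∫ z, {z : EuclideanSpace ℝ (Fin d) | δ < ‖z‖}.indicator f z ∂μ)
        (𝓝[>] (0:ℝ)) (𝓝 (∫ z, f z ∂μ)) := fun f hf hfi =>
    tendsto_integral_filter_of_dominated_convergence (fun z => |f z|)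
      (Eventually.of_forall fun δ => hfi.aestronglyMeasurable.indicator (hSm δ))
      (Eventually.of_forall fun δ => ae_of_all _ fun z => norm_indicator_le_norm_self f z) hfi.abs
      (ae_of_all _ (hindlim f hf))
  have hAlim := hintlim A (by simp [hA]) hAi
  have hI2ev : (fun δ => ∫ z, {z : EuclideanSpace ℝ (Fin d) | δ < ‖z‖}.indicator A z ∂μ -
        ∫ z, {z : EuclideanSpace ℝ (Fin d) | δ < ‖z‖}.indicator k z ∂μ) =ᶠ[𝓝[>] (0:ℝ)]
      fun δ => I2 μ (fun _ z => z) δ x p u := by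
    filter_upwards [self_mem_nhdsWithin] with δ hδ using (hI2 δ hδ).symm
  have hfin : Integrable k μ → Tendsto (fun δ => I2 μ (fun _ z => z) δ x p u) (𝓝[>] (0:ℝ))
      (𝓝 (∫ z, A z ∂μ - ∫ z, k z ∂μ)) := fun hki =>
    (hAlim.sub (hintlim k hkx hki)).congr' hI2ev
  have hinf : ¬ Integrable k μ →
      Tendsto (fun δ => I2 μ (fun _ z => z) δ x p u) (𝓝[>] (0:ℝ)) atBot := fun hki => by
    have hklim := tendsto_integral_atTop_of_not_integrable (l := 𝓝[>] (0:ℝ))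
      (fun δ => hkm.indicator (hSm δ))
      (fun δ z => Set.indicator_nonneg (fun z _ => hk0 z) z)
      (by filter_upwards [self_mem_nhdsWithin] with δ hδ using hkS δ hδ) hkm hk0
      (hindlim k hkx) hki
    refine Tendsto.congr' hI2ev ?_
    simp only [sub_eq_add_neg]
    exact hAlim.add_atBot (tendsto_neg_atTop_atBot.comp hklim)
  obtain ⟨g, δ, hδ, hg, hug, hgψ, hgeq, hglim⟩ := exists_seq_contDiff_majorant hu hψ huψ hψx
  have hgx : ∀ n, g n x = u x := fun n => by rw [hgeq n x (by simpa using (hδ n).1), hψx]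
  have hgev : ∀ n, g n =ᶠ[𝓝 x] ψ := fun n => by
    filter_upwards [ball_mem_nhds x (hδ n).1] with y hy using hgeq n y hy
  have hgrad : ∀ n, gradient (g n) x = gradient φ x := fun n =>
    gradient_eq_of_eventuallyEq_add_const (hgev n)
  have hgb : ∀ n y, |g n y| ≤ Cφ + (Cu + Cφ) + 1 + Cu := fun n y => by
    have h1 := hug n y
    have h2 := hgψ n y
    have h3 : δ n ^ 2 ≤ 1 := pow_le_one₀ (hδ n).1.le (hδ n).2
    have h4 := abs_le.1 (hψb y)
    have h5 := abs_le.1 (hCu y)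
    exact abs_le.2 ⟨by linarith, by linarith⟩
  have hFn : ∀ n, F x (u x) (gradient φ x) (hessM φ x) (ILI μ (fun _ z => z) x (g n)) ≤ 0 :=
    fun n => by
      have h := husub (g n) (hg n) ⟨_, hgb n⟩ x fun y => by
        rw [hgx, sub_self]; exact sub_nonpos.2 (hug n y)
      rwa [hgrad, hessM_eq_of_eventuallyEq_add_const (hgev n)] at h
  have hkgm : ∀ n, Measurable fun z => ψ (x + z) - g n (x + z) := fun n =>
    ((hψ.continuous.sub (hg n).continuous).comp (continuous_const_add x)).measurable
  have hkgi : ∀ n, Integrable (fun z => ψ (x + z) - g n (x + z)) μ := fun n =>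
    integrable_of_bounded_of_eq_zero hLevy (hkgm n)
      (fun z => (abs_sub _ _).trans (add_le_add (hψb _) (hgb n _))) (hδ n).1
      fun z hz => sub_eq_zero.2 (hgeq n _ (by simpa using hz)).symm
  have hkg0 : ∀ n z, 0 ≤ ψ (x + z) - g n (x + z) + q z := fun n z => by
    rcases lt_or_ge ‖z‖ (δ n) with h | h
    · rw [hgeq n _ (by simpa using h), sub_self, zero_add]
      exact hq0 z
    · have h1 : δ n ^ 2 ≤ q z := le_min (pow_le_pow_left₀ (hδ n).1.le h 2)
        (pow_le_one₀ (hδ n).1.le (hδ n).2)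
      linarith [hgψ n (x + z)]
  have hkglim : ∀ z, Tendsto (fun n => ψ (x + z) - g n (x + z) + q z) atTop (𝓝 (k z + q z)) :=
    fun z => ((hglim (x + z)).const_sub _).add_const _
  have hkgqm : ∀ n, Measurable fun z => ψ (x + z) - g n (x + z) + q z := fun n =>
    (hkgm n).add hqm
  have hkgqi : ∀ n, Integrable (fun z => ψ (x + z) - g n (x + z) + q z) μ := fun n =>
    (hkgi n).add hqi
  have hAqi : Integrable (fun z => A z + q z) μ := hAi.add hqi
  have hILI : ∀ n, ILI μ (fun _ z => z) x (g n) =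
      ∫ z, A z + q z ∂μ - ∫ z, ψ (x + z) - g n (x + z) + q z ∂μ := fun n => by
    rw [← integral_sub hAqi (hkgqi n)]
    refine integral_congr_ae (ae_of_all _ fun z => ?_)
    simp only [hgrad, hgx, hA, hp, hψdef]
    ring
  have hILIfin : Integrable k μ → Tendsto (fun n => ILI μ (fun _ z => z) x (g n)) atTop
      (𝓝 (∫ z, A z ∂μ - ∫ z, k z ∂μ)) := fun hki => by
    have hlim := tendsto_integral_of_dominated_convergence (fun z => k z + q z)
      (fun n => (hkgqm n).aestronglyMeasurable) (hki.add hqi)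
      (fun n => ae_of_all μ fun z => by
        rw [Real.norm_of_nonneg (hkg0 n z)]
        simp only [hk]
        linarith [hug n (x + z)])
      (ae_of_all μ hkglim)
    simp only [hILI]
    convert hlim.const_sub (∫ z, A z + q z ∂μ) using 2
    rw [integral_add hAi hqi, integral_add hki hqi]
    ring
  have hILIinf : ¬ Integrable k μ → Tendsto (fun n => ILI μ (fun _ z => z) x (g n)) atTop atBot :=
    fun hki => by
      have hlim := tendsto_integral_atTop_of_not_integrable (μ := μ)
        hkgqm hkg0 (Eventually.of_forall hkgqi)
        (hkm.add hqm) (fun z => add_nonneg (hk0 z) (hq0 z)) hkglim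
        fun h => hki (by simpa using h.sub hqi)
      simp only [hILI, sub_eq_add_neg (∫ z, A z + q z ∂μ)]
      exact tendsto_atBot_add_const_left _ _ (tendsto_neg_atTop_atBot.comp hlim)
  have hFl : Continuous fun l => F x (u x) (gradient φ x) (hessM φ x) l :=
    hFc.comp (f := fun l : ℝ => (x, u x, gradient φ x, hessM φ x, l)) (by fun_prop)
  refine ⟨fun δ hδ _ => ?_, ?_, fun Λ hΛ => ?_, fun _ ε hε => ⟨_, (hFn 0).trans hε.le⟩,
    fun hF => ?_⟩
  · simp only [hint]
    exact hAi.integrableOn.sub ((integrable_indicator_iff (hSm δ)).1 (hkS δ hδ))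
  · by_cases hki : Integrable k μ
    · exact Or.inl ⟨_, hfin hki⟩
    · exact Or.inr (hinf hki)
  · have hki : Integrable k μ := by
      by_contra hki
      exact not_tendsto_nhds_of_tendsto_atBot (hinf hki) Λ hΛ
    rw [tendsto_nhds_unique hΛ (hfin hki)]
    exact le_of_tendsto ((hFl.tendsto _).comp (hILIfin hki)) (Eventually.of_forall hFn)
  · by_cases hki : Integrable k μ
    · exact ⟨_, hfin hki⟩
    · obtain ⟨n, hn⟩ := ((hF.comp (hILIinf hki)).eventually_gt_atTop 0).exists
      exact absurd (hFn n) (not_le.2 hn)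
end
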